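/- arXiv:2003.08249 — 2 statements merged into one kernel-verified Lean document; each statement's English description precedes it below -/
import Mathlib

section
/- Let A be a DFA with n ≥ 3 states and initial state q₀, recognizing L. For every w ∈ S(L) there exists a factorization w = x y^i z with i ∈ ℕ, |xz| ≤ n³, |y| ≤ n, and q₀ · (xy) = q₀ · x. In particular x y* z ⊆ L. -/
/-- Radix (length-lexicographic) order on words over a linearly ordered alphabet. -/
def RadixLT {α : Type*} [LinearOrder α] (u v : List α) : Prop :=
  u.length < v.length ∨ (u.length = v.length ∧ List.Lex (· < ·) u v)

/-- `SWords L` is the set of length-wise lexicographically smallest words of `L`. -/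
def SWords {α : Type*} [LinearOrder α] (L : Set (List α)) : Set (List α) :=
  {u | u ∈ L ∧ ∀ v ∈ L, RadixLT v u → v.length < u.length}

/-- A language is thin if it contains at most one word of each length. -/
def Thin {α : Type*} (L : Set (List α)) : Prop :=
  ∀ n : ℕ, ∀ u ∈ L, ∀ v ∈ L, u.length = n → v.length = n → u = v

/-- `wpow l n` is the `n`-fold concatenation of the word `l`. -/
def wpow {α : Type*} (l : List α) : ℕ → List α
  | 0 => []
  | n + 1 => l ++ wpow l n

theorem lex_append_same {α : Type*} [LinearOrder α] {a b : List α}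
    (h : List.Lex (· < ·) a b) (hl : a.length = b.length) (s t r : List α) :
    List.Lex (· < ·) (r ++ (a ++ s)) (r ++ (b ++ t)) := by
  apply List.Lex.append_left
  induction h with
  | nil => simp at hl
  | cons h ih => exact List.Lex.cons (ih (by simpa using hl))
  | rel h => exact List.Lex.rel h

theorem lex_tri {α : Type*} [LinearOrder α] : ∀ a b : List α, a.length = b.length → a ≠ b →
    List.Lex (· < ·) a b ∨ List.Lex (· < ·) b a
  | [], [], _, h => absurd rfl h
  | [], _ :: _, h, _ => by simp at h
  | _ :: _, [], h, _ => by simp at h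
  | x :: a, y :: b, hl, h => by
    rcases lt_trichotomy x y with hxy | hxy | hxy
    · exact Or.inl (List.Lex.rel hxy)
    · subst hxy
      rcases lex_tri a b (by simpa using hl) (by simpa using h) with h | h
      · exact Or.inl (List.Lex.cons h)
      · exact Or.inr (List.Lex.cons h)
    · exact Or.inr (List.Lex.rel hxy)

theorem not_lex_of_SWords {α : Type*} [LinearOrder α] {L : Set (List α)} {w v : List α}
    (hw : w ∈ SWords L) (hv : v ∈ L) (hl : v.length = w.length) : ¬ List.Lex (· < ·) v w := by
  intro h
  have := hw.2 v hv (Or.inr ⟨hl, h⟩)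
  omega

theorem wpow_add {α : Type*} (l : List α) (a b : ℕ) : wpow l (a + b) = wpow l a ++ wpow l b := by
  induction a with
  | zero => simp [wpow]
  | succ a ih => rw [Nat.succ_add]; simp [wpow, ih]

theorem wpow_length {α : Type*} (l : List α) (a : ℕ) : (wpow l a).length = a * l.length := by
  induction a with
  | zero => simp [wpow]
  | succ a ih => simp [wpow, ih]; ring

theorem wpow_nil {α : Type*} (a : ℕ) : wpow ([] : List α) a = [] := by
  apply List.eq_nil_of_length_eq_zero; simp [wpow_length]

theorem wpow_one {α : Type*} (l : List α) : wpow l 1 = l := by simp [wpow]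

theorem eval_wpow {α σ : Type*} (M : DFA α σ) (p : σ) (l : List α) (h : M.evalFrom p l = p)
    (a : ℕ) : M.evalFrom p (wpow l a) = p := by
  induction a with
  | zero => simp [wpow]
  | succ a ih => simp [wpow, DFA.evalFrom_of_append, h, ih]

/-- Two loops of equal length in a minimal word commute with what is in between. -/
theorem loops_commute {α σ : Type*} [LinearOrder α] (M : DFA α σ) {w x U c V d : List α}
    (hw : w ∈ SWords M.accepts) (hwe : w = x ++ (U ++ (c ++ (V ++ d))))
    (hU : M.evalFrom (M.evalFrom M.start x) U = M.evalFrom M.start x)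
    (hV : M.evalFrom (M.evalFrom (M.evalFrom M.start x) c) V =
      M.evalFrom (M.evalFrom M.start x) c)
    (hl : U.length = V.length) : U ++ c = c ++ V := by
  by_contra hne
  have hacc : M.evalFrom M.start w ∈ M.accept := hw.1
  rw [hwe] at hacc
  simp only [DFA.evalFrom_of_append, hU, hV] at hacc
  rcases lex_tri _ _ (by simp; omega) hne with h | h
  · refine not_lex_of_SWords hw (v := (x ++ U) ++ ((U ++ c) ++ d)) ?_ ?_ ?_
    · change M.evalFrom M.start _ ∈ M.accept
      simp only [DFA.evalFrom_of_append, hU]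
      exact hacc
    · subst hwe; simp; omega
    · have := lex_append_same h (by simp; omega) d d (x ++ U)
      rw [hwe]; simpa using this
  · refine not_lex_of_SWords hw (v := x ++ ((c ++ V) ++ (V ++ d))) ?_ ?_ ?_
    · change M.evalFrom M.start _ ∈ M.accept
      simp only [DFA.evalFrom_of_append, hV]
      exact hacc
    · subst hwe; simp; omega
    · have := lex_append_same h (by simp; omega) (V ++ d) (V ++ d) x
      rw [hwe]; simpa using this

/-- The relation Rem M b k p t s: reading t from p, removing `k` disjoint loops of length `b`
yields s. -/
inductive Rem {α σ : Type*} (M : DFA α σ) (b : ℕ) : ℕ → σ → List α → List α → Prop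
  | nil (p : σ) : Rem M b 0 p [] []
  | cons {k : ℕ} {p : σ} {t s : List α} (a : α) (h : Rem M b k (M.step p a) t s) :
      Rem M b k p (a :: t) (a :: s)
  | loop {k : ℕ} {p : σ} {t s : List α} (v : List α) (hv : v.length = b)
      (he : M.evalFrom p v = p) (h : Rem M b k p t s) : Rem M b (k + 1) p (v ++ t) s

theorem Rem.refl {α σ : Type*} (M : DFA α σ) (b : ℕ) (t : List α) : ∀ p, Rem M b 0 p t t := by
  induction t with
  | nil => exact fun p => Rem.nil p
  | cons a t ih => exact fun p => Rem.cons a (ih _)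

theorem Rem.append {α σ : Type*} {M : DFA α σ} {b k l : ℕ} {p : σ} {t t' s s' : List α}
    (h : Rem M b k p t t') (h2 : Rem M b l (M.evalFrom p t) s s') :
    Rem M b (k + l) p (t ++ s) (t' ++ s') := by
  induction h with
  | nil p => simpa using h2
  | cons a h ih => exact Rem.cons a (ih h2)
  | loop v hv he h ih =>
    rw [DFA.evalFrom_of_append, he] at h2
    have := Rem.loop v hv he (ih h2)
    rw [List.append_assoc, Nat.add_right_comm]
    exact this

theorem Rem.first {α σ : Type*} {M : DFA α σ} {b k : ℕ} {p : σ} {t t' : List α}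
    (h : Rem M b k p t t') : (k = 0 ∧ t = t') ∨ ∃ a v s s' l, t = a ++ (v ++ s) ∧ t' = a ++ s' ∧
      k = l + 1 ∧ v.length = b ∧ M.evalFrom (M.evalFrom p a) v = M.evalFrom p a ∧
      Rem M b l (M.evalFrom p a) s s' := by
  induction h with
  | nil p => simp
  | cons a h ih =>
    rcases ih with ⟨h1, h2⟩ | ⟨a', v, s, s', l, h1, h2, h3, h4, h5, h6⟩
    · left; simp [h1, h2]
    · right
      exact ⟨a :: a', v, s, s', l, by simp [h1], by simp [h2], h3, h4, h5, h6⟩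
  | @loop k p t s v hv he h ih =>
    right
    exact ⟨[], v, t, s, k, rfl, rfl, rfl, hv, he, h⟩

theorem Rem.eval {α σ : Type*} {M : DFA α σ} {b k : ℕ} {p : σ} {t t' : List α}
    (h : Rem M b k p t t') : M.evalFrom p t = M.evalFrom p t' := by
  induction h with
  | nil p => rfl
  | cons a h ih => simpa using ih
  | loop v hv he h ih => rw [DFA.evalFrom_of_append, he, ih]

theorem gather {α σ : Type*} [LinearOrder α] (M : DFA α σ) {w x v : List α} {b : ℕ}
    (hw : w ∈ SWords M.accepts) (hvb : v.length = b)
    (hv : M.evalFrom (M.evalFrom M.start x) v = M.evalFrom M.start x)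
    {k : ℕ} {p : σ} {t t' : List α} (h : Rem M b k p t t') :
    ∀ (j : ℕ) (A : List α), M.evalFrom (M.evalFrom M.start x) A = p →
      w = x ++ (wpow v (j + 1) ++ (A ++ t)) → w = x ++ (wpow v (j + 1 + k) ++ (A ++ t')) := by
  induction h with
  | nil p => intro j A _ h; exact h
  | cons a h ih =>
    intro j A hA hwe
    have := ih j (A ++ [a]) (by simp [DFA.evalFrom_of_append, hA]) (by simpa using hwe)
    simpa using this
  | @loop k p t s v' hv' he h ih =>
    intro j A hA hwe
    have hjv := eval_wpow M _ v hv j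
    have hc : v ++ A = A ++ v' := by
      refine loops_commute M (x := x ++ wpow v j) (d := t) hw ?_ ?_ ?_ (by omega)
      · rw [hwe, wpow_add, wpow_one]; simp
      · simp only [DFA.evalFrom_of_append, hjv, hv]
      · simp only [DFA.evalFrom_of_append, hjv, hA, he]
    have := ih (j + 1) A hA (by
      rw [hwe, wpow_add v (j + 1) 1, wpow_one, ← List.append_assoc A, ← hc]
      simp)
    rw [this]
    congr 3
    omega

theorem many_loops {α σ : Type*} [Fintype σ] (M : DFA α σ) (q : ℕ) : ∀ (p : σ) (t : List α),
    q * Fintype.card σ ≤ t.length → ∃ f : ℕ → ℕ, q = ∑ b ∈ Finset.Icc 1 (Fintype.card σ), f b ∧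
      ∀ b, ∃ t', Rem M b (f b) p t t' := by
  induction q with
  | zero =>
    intro p t _
    exact ⟨fun _ => 0, by simp, fun b => ⟨t, Rem.refl M b t p⟩⟩
  | succ q ih =>
    intro p t ht
    rw [Nat.succ_mul] at ht
    obtain ⟨s, a, v, c, h1, h2, h3, h4, h5, h6⟩ :=
      M.evalFrom_split (x := t) (s := p) (t := M.evalFrom p t) (by omega) rfl
    have hlen : t.length = a.length + v.length + c.length := by rw [h1]; simp; ring
    obtain ⟨f, hf, hR⟩ := ih s c (by omega)
    have hvpos : 0 < v.length := List.length_pos_iff.2 h3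
    refine ⟨fun b => (if b = v.length then 1 else 0) + f b, ?_, ?_⟩
    · rw [Finset.sum_add_distrib, ← hf, Finset.sum_ite_eq', if_pos]
      · ring
      · simp; omega
    · intro b
      obtain ⟨c', hc'⟩ := hR b
      rw [h1, List.append_assoc]
      by_cases hb : b = v.length
      · refine ⟨a ++ c', ?_⟩
        have := (Rem.refl M b a p).append (s := v ++ c) (s' := c') (l := f b + 1)
          (by rw [h4]; exact Rem.loop v hb.symm h5 hc')
        simpa [hb, add_comm] using this
      · refine ⟨a ++ (v ++ c'), ?_⟩
        have := (Rem.refl M b a p).append (s := v ++ c) (s' := v ++ c') (l := 0 + f b)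
          (by rw [h4]; exact (Rem.refl M b v s).append (by rw [h5]; exact hc'))
        simpa [hb] using this

theorem exists_big {n : ℕ} (f : ℕ → ℕ) (h : n * (n - 1) < ∑ b ∈ Finset.Icc 1 n, f b) :
    ∃ b, 1 ≤ b ∧ b ≤ n ∧ n ≤ f b := by
  by_contra! hc
  have : ∑ b ∈ Finset.Icc 1 n, f b ≤ ∑ b ∈ Finset.Icc 1 n, (n - 1) := by
    apply Finset.sum_le_sum
    intro b hb
    rw [Finset.mem_Icc] at hb
    have := hc b hb.1 hb.2
    omega
  simp at this
  omega

theorem reduce {α σ : Type*} [LinearOrder α] [Fintype σ] (M : DFA α σ)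
    (hn : 3 ≤ Fintype.card σ) (w : List α) (hw : w ∈ SWords M.accepts) (N : ℕ) :
    ∀ (x u z : List α) (m : ℕ), x.length + z.length = N → w = x ++ (wpow u m ++ z) →
      M.evalFrom (M.evalFrom M.start x) u = M.evalFrom M.start x → 1 ≤ u.length →
      u.length ≤ Fintype.card σ → Fintype.card σ ≤ m →
      ∃ (x u z : List α) (m : ℕ), x.length + z.length ≤ (Fintype.card σ) ^ 3 ∧
        w = x ++ (wpow u m ++ z) ∧
        M.evalFrom (M.evalFrom M.start x) u = M.evalFrom M.start x ∧
        u.length ≤ Fintype.card σ := by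
  induction N using Nat.strong_induction_on with
  | _ N ih =>
  intro x u z m hN hwe hu hu1 hun hm
  by_cases hbig : x.length + z.length ≤ (Fintype.card σ) ^ 3
  · exact ⟨x, u, z, m, hbig, hwe, hu, hun⟩
  have hum := eval_wpow M _ u hu m
  set n := Fintype.card σ with hndef
  obtain ⟨f, hf, hfR⟩ := many_loops M (x.length / n) M.start x (Nat.div_mul_le_self _ _)
  obtain ⟨g, hg, hgR⟩ := many_loops M (z.length / n) (M.evalFrom M.start x) z
    (Nat.div_mul_le_self _ _)
  have hcount : n * (n - 1) < x.length / n + z.length / n := by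
    have h1 := Nat.div_add_mod x.length n
    have h2 := Nat.div_add_mod z.length n
    have h3 := Nat.mod_lt x.length (show n > 0 by omega)
    have h4 := Nat.mod_lt z.length (show n > 0 by omega)
    generalize x.length / n = q1 at *
    generalize z.length / n = q2 at *
    obtain ⟨c, hc⟩ : ∃ c, n = c + 1 := ⟨n - 1, by omega⟩
    by_contra hcon
    have h5 : q1 + q2 ≤ n * (n - 1) := by omega
    have h6 : n * (q1 + q2) ≤ n * (n * (n - 1)) := Nat.mul_le_mul_left _ h5
    rw [hc] at h6 h1 h2 h3 h4 hbig hn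
    simp only [Nat.add_sub_cancel] at h6
    nlinarith
  rw [hf, hg, ← Finset.sum_add_distrib] at hcount
  obtain ⟨b, hb1, hbn, hb⟩ := exists_big _ hcount
  obtain ⟨x', hx'⟩ := hfR b
  obtain ⟨z', hz'⟩ := hgR b
  obtain ⟨e, he⟩ : ∃ e, m = b + e := ⟨m - b, by omega⟩
  have hub := eval_wpow M _ u hu b
  have hpos : 0 < b * u.length := by positivity
  rcases hx'.first with ⟨h0, hxx⟩ | ⟨a, v, s, s', l, h1, h2, h3, h4, h5, h6⟩
  · rcases hz'.first with ⟨h0', -⟩ | ⟨a, v, s, s', l, h1, h2, h3, h4, h5, h6⟩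
    · omega
    · -- all loops lie in `z`
      have h5' : M.evalFrom (M.evalFrom M.start (x ++ (wpow u m ++ a))) v =
          M.evalFrom M.start (x ++ (wpow u m ++ a)) := by
        simp only [DFA.evalFrom_of_append, hum, h5]
      have hG := gather M (x := x ++ (wpow u m ++ a)) hw h4 h5' h6 0 []
        (by simp [DFA.evalFrom_of_append, hum]) (by rw [hwe, h1]; simp [wpow])
      obtain ⟨r, hr⟩ : ∃ r, 0 + 1 + l = u.length + r := ⟨1 + l - u.length, by omega⟩
      have hlen := congrArg List.length hG
      rw [hr] at hG
      have hvu := eval_wpow M _ v h5 u.length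
      have hw1 : w = x ++ (wpow u e ++ (wpow u b ++ (a ++ (wpow v u.length ++
          (wpow v r ++ s'))))) := by
        rw [hG, he, add_comm b e]; simp [wpow_add]
      have hue := eval_wpow M _ u hu e
      have hC := loops_commute M (x := x ++ wpow u e) (U := wpow u b) (c := a)
        (V := wpow v u.length) (d := wpow v r ++ s') hw (by rw [hw1]; simp)
        (by simp only [DFA.evalFrom_of_append, hue, hub])
        (by simp only [DFA.evalFrom_of_append, hue, hvu])
        (by simp only [wpow_length, h4]; ring)
      have hw2 : w = x ++ (wpow u (e + b + b) ++ (a ++ (wpow v r ++ s'))) := by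
        rw [hw1, ← List.append_assoc a, ← hC]; simp [wpow_add]
      refine ih _ ?_ x u (a ++ (wpow v r ++ s')) (e + b + b) rfl hw2 hu hu1 hun (by omega)
      have l1 := congrArg List.length hwe
      have l2 := congrArg List.length hw2
      simp only [List.length_append, wpow_length, he, add_mul] at l1 l2 ⊢
      omega
  · -- the first loop lies in `x`
    have hxe : M.evalFrom M.start x = M.evalFrom (M.evalFrom M.start a) s := by
      rw [h1]; simp only [DFA.evalFrom_of_append, h5]
    have hR : Rem M b (l + (0 + g b)) (M.evalFrom M.start a) (s ++ (wpow u m ++ z))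
        (s' ++ (wpow u m ++ z')) := by
      refine h6.append ((Rem.refl M b _ _).append ?_)
      rw [← hxe, hum]; exact hz'
    have hG := gather M (x := a) hw h4 h5 hR 0 [] (by simp) (by rw [hwe, h1]; simp [wpow])
    have hs' : M.evalFrom (M.evalFrom M.start a) s' = M.evalFrom M.start x := by
      rw [hxe]; exact h6.eval.symm
    obtain ⟨r, hr⟩ : ∃ r, 0 + 1 + (l + (0 + g b)) = r + u.length :=
      ⟨1 + (l + g b) - u.length, by omega⟩
    rw [hr] at hG
    have hvu := eval_wpow M _ v h5 u.length
    have hvr := eval_wpow M _ v h5 r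
    have hw1 : w = a ++ (wpow v r ++ (wpow v u.length ++ (s' ++ (wpow u b ++
        (wpow u e ++ z'))))) := by
      rw [hG, he]; simp [wpow_add]
    have hC := loops_commute M (x := a ++ wpow v r) (U := wpow v u.length) (c := s')
      (V := wpow u b) (d := wpow u e ++ z') hw (by rw [hw1]; simp)
      (by simp only [DFA.evalFrom_of_append, hvr, hvu])
      (by simp only [DFA.evalFrom_of_append, hvr, hs', hub])
      (by simp only [wpow_length, h4]; ring)
    have hw2 : w = (a ++ (wpow v r ++ s')) ++ (wpow u (b + b + e) ++ z') := by
      rw [hw1, ← List.append_assoc (wpow v u.length), hC]; simp [wpow_add]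
    refine ih _ ?_ (a ++ (wpow v r ++ s')) u z' (b + b + e) rfl hw2
      (by simp only [DFA.evalFrom_of_append, hvr, hs', hu]) hu1 hun (by omega)
    have l1 := congrArg List.length hwe
    have l2 := congrArg List.length hw2
    simp only [List.length_append, wpow_length, he, add_mul] at l1 l2 ⊢
    omega

theorem stmt8 {α σ : Type*} [LinearOrder α] [Fintype σ] (M : DFA α σ)
    (hn : 3 ≤ Fintype.card σ) (w : List α) (hw : w ∈ SWords M.accepts) :
    ∃ (x y z : List α) (i : ℕ),
      w = x ++ wpow y i ++ z ∧
      (x ++ z).length ≤ (Fintype.card σ) ^ 3 ∧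
      y.length ≤ Fintype.card σ ∧
      M.evalFrom M.start (x ++ y) = M.evalFrom M.start x ∧
      ∀ m : ℕ, x ++ wpow y m ++ z ∈ M.accepts := by
  by_cases hbig : w.length ≤ (Fintype.card σ) ^ 3
  · refine ⟨w, [], [], 0, by simp [wpow], by simpa using hbig, by simp, by simp, ?_⟩
    intro m
    rw [wpow_nil]
    have h := hw.1
    simp only [List.append_nil]
    exact h
  have key : ∃ (x u z : List α) (m : ℕ), x.length + z.length ≤ (Fintype.card σ) ^ 3 ∧
        w = x ++ (wpow u m ++ z) ∧
        M.evalFrom (M.evalFrom M.start x) u = M.evalFrom M.start x ∧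
        u.length ≤ Fintype.card σ := by
    obtain ⟨f, hf, hR⟩ := many_loops M (Fintype.card σ ^ 2) M.start w (by
      rw [← pow_succ]; exact (not_le.1 hbig).le)
    obtain ⟨b, hb1, hbn, hb⟩ := exists_big f (by
      rw [← hf, pow_two]; exact Nat.mul_lt_mul_of_pos_left (by omega) (by omega))
    obtain ⟨w', hw'⟩ := hR b
    rcases hw'.first with ⟨h0, -⟩ | ⟨a, v, s, s', l, h1, h2, h3, h4, h5, h6⟩
    · omega
    have hG := gather M (x := a) hw h4 h5 h6 0 [] (by simp) (by rw [h1]; simp [wpow])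
    exact reduce M hn w hw _ a v s' (0 + 1 + l) rfl (by simpa using hG) h5 (by omega) (by omega)
      (by omega)
  obtain ⟨x, u, z, m, h1, h2, h3, h4⟩ := key
  refine ⟨x, u, z, m, by rw [h2]; simp, by simpa using h1, h4, ?_, ?_⟩
  · rw [DFA.evalFrom_of_append, h3]
  · intro i
    have hacc : M.evalFrom M.start w ∈ M.accept := hw.1
    rw [h2] at hacc
    change M.evalFrom M.start _ ∈ M.accept
    simp only [DFA.evalFrom_of_append, eval_wpow M _ u h3] at hacc ⊢
    exact hacc
end

section
/- Let A be a DFA over Σ with initial state q₀ and L = L(A). Suppose x, y, z and x', y', z' satisfy q₀·x = q₀·(xy) and q₀·x' = q₀·(x'y'), and suppose there exist factorizations y = uv, y' = u'v' with q₀·(xu) = q₀·(x'u') and (vu)^{|y'|} < (v'u')^{|y|} in radix order. Then every word of the form x'(y')^i z' ∈ L with i > |y| is not in S(L); specifically the strictly smaller word x'u'(vu)^{|y'|}(v'u')^{i-|y|-1}v'z' of the same length also lies in L. -/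
theorem aux_len {α : Type*} (l : List α) (n : ℕ) : (wpow l n).length = n * l.length := by
  induction n with
  | zero => simp [wpow]
  | succ n ih => simp [wpow, ih]; ring

theorem aux_add {α : Type*} (l : List α) (m n : ℕ) : wpow l (m + n) = wpow l m ++ wpow l n := by
  induction m with
  | zero => simp [wpow]
  | succ m ih => rw [Nat.add_right_comm]; simp [wpow, ih]

theorem aux_rot {α : Type*} (a b : List α) (n : ℕ) :
    wpow (a ++ b) (n + 1) = a ++ wpow (b ++ a) n ++ b := by
  induction n with
  | zero => simp [wpow]
  | succ n ih =>
    rw [wpow, ih]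
    simp [wpow]

theorem aux_eval {α σ : Type*} (M : DFA α σ) (p : σ) (l : List α) (h : M.evalFrom p l = p)
    (n : ℕ) : M.evalFrom p (wpow l n) = p := by
  induction n with
  | zero => simp [wpow]
  | succ n ih => rw [wpow, DFA.evalFrom_of_append, h, ih]

theorem aux_lex_left {α : Type*} [LinearOrder α] (a b c : List α)
    (h : List.Lex (· < ·) b c) : List.Lex (· < ·) (a ++ b) (a ++ c) := by
  induction a with
  | nil => exact h
  | cons d a ih => exact List.Lex.cons ih

theorem aux_lex_right {α : Type*} [LinearOrder α] (a b c : List α)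
    (h : List.Lex (· < ·) a b) (hl : a.length = b.length) :
    List.Lex (· < ·) (a ++ c) (b ++ c) := by
  induction h with
  | nil => simp at hl
  | cons _ ih => exact List.Lex.cons (ih (by simpa using hl))
  | rel h => exact List.Lex.rel h

theorem stmt10 {α σ : Type*} [LinearOrder α] (M : DFA α σ)
    (x y z x' y' z' u v u' v' : List α)
    (hy : y = u ++ v) (hy' : y' = u' ++ v')
    (hx : M.evalFrom M.start x = M.evalFrom M.start (x ++ y))
    (hx' : M.evalFrom M.start x' = M.evalFrom M.start (x' ++ y'))
    (hmeet : M.evalFrom M.start (x ++ u) = M.evalFrom M.start (x' ++ u'))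
    (hlt : RadixLT (wpow (v ++ u) y'.length) (wpow (v' ++ u') y.length))
    (i : ℕ) (hi : y.length < i)
    (hmem : x' ++ wpow y' i ++ z' ∈ M.accepts) :
    (x' ++ u' ++ wpow (v ++ u) y'.length ++ wpow (v' ++ u') (i - y.length - 1) ++ v' ++ z')
        ∈ M.accepts ∧
    (x' ++ u' ++ wpow (v ++ u) y'.length ++ wpow (v' ++ u') (i - y.length - 1) ++ v' ++ z').length
        = (x' ++ wpow y' i ++ z').length ∧
    RadixLT
      (x' ++ u' ++ wpow (v ++ u) y'.length ++ wpow (v' ++ u') (i - y.length - 1) ++ v' ++ z')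
      (x' ++ wpow y' i ++ z') ∧
    x' ++ wpow y' i ++ z' ∉ SWords M.accepts := by
  obtain ⟨k, rfl⟩ : ∃ k, i = y.length + k + 1 := ⟨i - y.length - 1, by omega⟩
  have hk : y.length + k + 1 - y.length - 1 = k := by omega
  rw [hk]
  have hw : x' ++ wpow y' (y.length + k + 1) ++ z' =
      x' ++ u' ++ (wpow (v' ++ u') y.length ++ (wpow (v' ++ u') k ++ v' ++ z')) := by
    rw [hy', aux_rot, aux_add]; simp
  have hw2 : x' ++ u' ++ wpow (v ++ u) y'.length ++ wpow (v' ++ u') k ++ v' ++ z' =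
      x' ++ u' ++ (wpow (v ++ u) y'.length ++ (wpow (v' ++ u') k ++ v' ++ z')) := by
    simp
  have hlen : (wpow (v ++ u) y'.length).length = (wpow (v' ++ u') y.length).length := by
    rw [aux_len, aux_len, hy, hy']; simp; ring
  rw [hw] at hmem ⊢
  rw [hw2]
  have e1 : M.evalFrom (M.evalFrom M.start (x' ++ u')) (v ++ u)
      = M.evalFrom M.start (x' ++ u') := by
    rw [← hmeet, ← DFA.evalFrom_of_append]
    have : x ++ u ++ (v ++ u) = (x ++ y) ++ u := by simp [hy]
    rw [this, DFA.evalFrom_of_append, ← hx, ← DFA.evalFrom_of_append]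
  have e2 : M.evalFrom (M.evalFrom M.start (x' ++ u')) (v' ++ u')
      = M.evalFrom M.start (x' ++ u') := by
    rw [← DFA.evalFrom_of_append]
    have : x' ++ u' ++ (v' ++ u') = (x' ++ y') ++ u' := by simp [hy']
    rw [this, DFA.evalFrom_of_append, ← hx', ← DFA.evalFrom_of_append]
  have hacc : x' ++ u' ++ (wpow (v ++ u) y'.length ++ (wpow (v' ++ u') k ++ v' ++ z'))
      ∈ M.accepts := by
    rw [DFA.mem_accepts, DFA.eval, DFA.evalFrom_of_append, DFA.evalFrom_of_append] at hmem ⊢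
    rw [aux_eval M _ _ e2] at hmem
    rw [aux_eval M _ _ e1]
    exact hmem
  have hl : (x' ++ u' ++ (wpow (v ++ u) y'.length ++ (wpow (v' ++ u') k ++ v' ++ z'))).length
      = (x' ++ u' ++ (wpow (v' ++ u') y.length ++ (wpow (v' ++ u') k ++ v' ++ z'))).length := by
    simp only [List.length_append, hlen]
  have hr : RadixLT (x' ++ u' ++ (wpow (v ++ u) y'.length ++ (wpow (v' ++ u') k ++ v' ++ z')))
      (x' ++ u' ++ (wpow (v' ++ u') y.length ++ (wpow (v' ++ u') k ++ v' ++ z'))) := by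
    refine Or.inr ⟨hl, aux_lex_left _ _ _ (aux_lex_right _ _ _ ?_ hlen)⟩
    rcases hlt with h | h
    · omega
    · exact h.2
  refine ⟨hacc, hl, hr, fun hs => ?_⟩
  have := hs.2 _ hacc hr
  omega
end
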